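/- Let G be a tournament graph on n vertices that is (ν₊, ν₋)-ambiguous with respect to a ground-truth ordering, and let i be a natural number with 1 ≤ i < n − ν₋. Then exactly i vertices of G have simple in-degree at least n − i − ν₋; in particular, exactly one vertex (the vertex of order 1) has simple in-degree at least n − 1 − ν₋. -/

import Mathlib

/-- A tournament graph on `n` vertices: a directed graph without self-loops in which,
for every pair of distinct vertices, at least one of the two directed edges is present
(possibly both). -/
def IsTournament {n : ℕ} (E : Fin n → Fin n → Bool) : Prop :=
  (∀ x, ¬ E x x) ∧ (∀ x y : Fin n, x ≠ y → E x y ∨ E y x)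

/-- The edge `(x, y)` is simple: it is present and the reverse edge is absent. -/
def IsSimple {n : ℕ} (E : Fin n → Fin n → Bool) (x y : Fin n) : Prop :=
  E x y ∧ ¬ E y x

/-- The pair `{x, y}` forms a two-cycle: both directed edges are present. -/
def IsTwoCycle {n : ℕ} (E : Fin n → Fin n → Bool) (x y : Fin n) : Prop :=
  E x y ∧ E y x

instance {n : ℕ} (E : Fin n → Fin n → Bool) (x y : Fin n) :
    Decidable (IsTwoCycle E x y) :=
  inferInstanceAs (Decidable (_ ∧ _))

instance {n : ℕ} (E : Fin n → Fin n → Bool) (x y : Fin n) :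
    Decidable (IsSimple E x y) :=
  inferInstanceAs (Decidable (_ ∧ _))

/-- Simple in-degree: the number of simple edges pointing into `x`. -/
def dIn {n : ℕ} (E : Fin n → Fin n → Bool) (x : Fin n) : ℕ :=
  (Finset.univ.filter fun y => IsSimple E y x).card

/-- Simple out-degree: the number of simple edges pointing out of `x`. -/
def dOut {n : ℕ} (E : Fin n → Fin n → Bool) (x : Fin n) : ℕ :=
  (Finset.univ.filter fun y => IsSimple E x y).card

/-- A tournament graph is `(ν₁, ν₂)`-ambiguous with respect to a ground-truth ordering `σ`
(where the vertex `x` has order `(σ x : ℕ) + 1 ∈ {1, …, n}`, i.e. `σ` is 0-indexed):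
(1) every simple edge points in the correct direction (from larger to smaller order), and
(2) the vertex of order `i` has exactly `min (i-1) ν₁` two-cycles with vertices of smaller
order and exactly `min (n-i) ν₂` two-cycles with vertices of larger order. -/
def IsAmbiguous {n : ℕ} (ν₁ ν₂ : ℕ) (E : Fin n → Fin n → Bool)
    (σ : Equiv.Perm (Fin n)) : Prop :=
  (∀ x y : Fin n, IsSimple E x y → σ y < σ x) ∧
  (∀ x : Fin n,
    (Finset.univ.filter fun y => σ y < σ x ∧ IsTwoCycle E x y).card
      = min (σ x : ℕ) ν₁) ∧
  (∀ x : Fin n,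
    (Finset.univ.filter fun y => σ x < σ y ∧ IsTwoCycle E x y).card
      = min (n - 1 - (σ x : ℕ)) ν₂)

/-- The simple in-neighbours and the larger two-cycle partners of a vertex partition the
vertices of larger order. -/
theorem IsAmbiguous.dIn_add_min {n ν₁ ν₂ : ℕ} {E : Fin n → Fin n → Bool}
    (hT : IsTournament E) {σ : Equiv.Perm (Fin n)} (h : IsAmbiguous ν₁ ν₂ E σ) (x : Fin n) :
    dIn E x + min (n - 1 - (σ x : ℕ)) ν₂ = n - 1 - (σ x : ℕ) := by
  obtain ⟨hdir, -, hlarge⟩ := h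
  have hcard : (Finset.univ.filter fun y => σ x < σ y).card = n - 1 - (σ x : ℕ) := by
    rw [← Fin.card_Ioi]
    exact Finset.card_equiv σ (by simp)
  rw [← hlarge x, ← hcard, dIn, ← Finset.card_union_of_disjoint]
  · congr 1
    ext y
    simp only [Finset.mem_union, Finset.mem_filter, Finset.mem_univ, true_and]
    constructor
    · rintro (hy | hy)
      · exact hdir y x hy
      · exact hy.1
    · intro hy
      have hne : x ≠ y := by
        rintro rfl
        exact lt_irrefl _ hy
      have hxy : ¬ IsSimple E x y := fun hs => lt_asymm hy (hdir x y hs)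
      have hedge := hT.2 x y hne
      unfold IsSimple at hxy ⊢
      unfold IsTwoCycle
      tauto
  · rw [Finset.disjoint_filter]
    exact fun y _ hy hc => hy.2 hc.2.1

/-- In a `(ν₊, ν₋)`-ambiguous tournament graph, for `1 ≤ i < n - ν₋`,
exactly `i` vertices have simple in-degree at least `n - i - ν₋`. -/
theorem ambiguous_card_large_in_degree {n ν₁ ν₂ : ℕ}
    (E : Fin n → Fin n → Bool) (hT : IsTournament E)
    (σ : Equiv.Perm (Fin n)) (h : IsAmbiguous ν₁ ν₂ E σ)
    (i : ℕ) (hi1 : 1 ≤ i) (hi2 : i < n - ν₂) :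
    (Finset.univ.filter fun x => n - i - ν₂ ≤ dIn E x).card = i := by
  have hiff : ∀ x, n - i - ν₂ ≤ dIn E x ↔ (σ x : ℕ) < i := by
    intro x
    have hx := h.dIn_add_min hT x
    omega
  simp only [hiff]
  have hin : i < n := by omega
  calc (Finset.univ.filter fun x => (σ x : ℕ) < i).card
      = (Finset.Iio (⟨i, hin⟩ : Fin n)).card :=
        Finset.card_equiv σ (by simp [Fin.lt_def])
    _ = i := Fin.card_Iio _
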